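/- Let H ∈ ℝ^{n×n} be positive stable, let P̄ be a symmetric positive definite matrix with Hᵀ P̄ + P̄ H = I_n, let 0 < γ < 1, and let k > λ_max(P̄) / (2γ(1−γ²)). Let α : [t₀,∞) → ℝ be continuous with α(t) > 0 for all t and ∫_{t₀}^{∞} α(s) ds = ∞, and let F₀ = [[−kH, I_n], [−γkH, 0]] ∈ ℝ^{2n×2n}. If ε : [t₀,∞) → ℝ^{2n} is differentiable and satisfies the (noise-free) error dynamics ε′(t) = α(t)·F₀·ε(t) for all t ≥ t₀, then ε(t) → 0 as t → ∞. -/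

import Mathlib

open Matrix Set Filter

section QuadraticForm

variable {ι : Type*} [Fintype ι] [DecidableEq ι] {P : Matrix ι ι ℝ}

/-- The quadratic form of a real symmetric matrix in coordinates along an orthonormal
eigenbasis. -/
lemma Matrix.IsHermitian.exists_dotProduct_mulVec_eq_sum_eigenvalues (hP : P.IsHermitian)
    (x : ι → ℝ) :
    ∃ y : ι → ℝ, x ⬝ᵥ P *ᵥ x = ∑ i, hP.eigenvalues i * y i ^ 2 ∧ x ⬝ᵥ x = ∑ i, y i ^ 2 := by
  set U : Matrix ι ι ℝ := (hP.eigenvectorUnitary : Matrix ι ι ℝ) with hU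
  have hUU : U * Uᵀ = 1 := by
    have := Unitary.coe_mul_star_self hP.eigenvectorUnitary
    simpa [star_eq_conjTranspose, hU] using this
  have hspec : P = U * diagonal hP.eigenvalues * Uᵀ := by
    have := hP.spectral_theorem
    rw [Unitary.conjStarAlgAut_apply] at this
    simpa [star_eq_conjTranspose, hU, Function.comp_def] using this
  refine ⟨Uᵀ *ᵥ x, ?_, ?_⟩
  · have hform : x ⬝ᵥ P *ᵥ x = (Uᵀ *ᵥ x) ⬝ᵥ diagonal hP.eigenvalues *ᵥ (Uᵀ *ᵥ x) := by
      conv_lhs => rw [hspec]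
      rw [← mulVec_mulVec, ← mulVec_mulVec, dotProduct_mulVec, mulVec_transpose]
    rw [hform]
    simp only [dotProduct, mulVec_diagonal]
    exact Finset.sum_congr rfl fun i _ => by ring
  · have hform : x ⬝ᵥ x = (Uᵀ *ᵥ x) ⬝ᵥ (Uᵀ *ᵥ x) := by
      conv_rhs => rw [dotProduct_mulVec, ← mulVec_transpose, transpose_transpose, mulVec_mulVec,
        hUU, one_mulVec]
    rw [hform]
    simp only [dotProduct]
    exact Finset.sum_congr rfl fun i _ => by ring

lemma Matrix.IsHermitian.dotProduct_mulVec_le_iSup_eigenvalues (hP : P.IsHermitian)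
    (x : ι → ℝ) : x ⬝ᵥ P *ᵥ x ≤ (⨆ i, hP.eigenvalues i) * (x ⬝ᵥ x) := by
  obtain ⟨y, hq, hn⟩ := hP.exists_dotProduct_mulVec_eq_sum_eigenvalues x
  rw [hq, hn, Finset.mul_sum]
  gcongr with i
  exact le_ciSup (Set.finite_range hP.eigenvalues).bddAbove i

lemma Matrix.PosDef.exists_pos_mul_le_dotProduct_mulVec [Nonempty ι] (hP : P.PosDef) :
    ∃ m > 0, ∀ x : ι → ℝ, m * (x ⬝ᵥ x) ≤ x ⬝ᵥ P *ᵥ x := by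
  obtain ⟨j, hj⟩ := Finite.exists_min hP.1.eigenvalues
  refine ⟨_, hP.eigenvalues_pos j, fun x => ?_⟩
  obtain ⟨y, hq, hn⟩ := hP.1.exists_dotProduct_mulVec_eq_sum_eigenvalues x
  rw [hq, hn, Finset.mul_sum]
  gcongr with i
  exact hj i

end QuadraticForm

lemma Matrix.IsSymm.dotProduct_mulVec_comm {ι : Type*} [Fintype ι] {P : Matrix ι ι ℝ}
    (hP : P.IsSymm) (x y : ι → ℝ) : x ⬝ᵥ P *ᵥ y = y ⬝ᵥ P *ᵥ x := by
  rw [dotProduct_mulVec, ← mulVec_transpose, hP.eq, dotProduct_comm]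

lemma HasDerivWithinAt.dotProduct_mulVec {ι : Type*} [Fintype ι] (P : Matrix ι ι ℝ)
    {x y : ℝ → ι → ℝ} {x' y' : ι → ℝ} {s : Set ℝ} {t : ℝ}
    (hx : HasDerivWithinAt x x' s t) (hy : HasDerivWithinAt y y' s t) :
    HasDerivWithinAt (fun τ => x τ ⬝ᵥ P *ᵥ y τ) (x' ⬝ᵥ P *ᵥ y t + x t ⬝ᵥ P *ᵥ y') s t := by
  have hx := hasDerivWithinAt_pi.1 hx
  have hy := hasDerivWithinAt_pi.1 hy
  simp only [dotProduct, mulVec]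
  rw [← Finset.sum_add_distrib]
  refine HasDerivWithinAt.fun_sum fun i _ => (hx i).mul ?_
  exact HasDerivWithinAt.fun_sum fun j _ => (hy j).const_mul _

/-- If `V ≥ 0` satisfies `V' ≤ -c α V` with `c > 0` and `∫ α = ∞`, then `V → 0`. -/
lemma tendsto_zero_of_deriv_le_neg_mul {t₀ c : ℝ} (hc : 0 < c) {α V V' : ℝ → ℝ}
    (hα : ContinuousOn α (Ici t₀))
    (hdiv : Tendsto (fun t => ∫ s in t₀..t, α s) atTop atTop)
    (hV : ∀ t ∈ Ici t₀, HasDerivWithinAt V (V' t) (Ici t₀) t)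
    (hV0 : ∀ t ∈ Ici t₀, 0 ≤ V t) (hV' : ∀ t ∈ Ici t₀, V' t ≤ -(c * α t * V t)) :
    Tendsto V atTop (nhds 0) := by
  set β : ℝ → ℝ := fun t => α (max t₀ t) with hβ
  have hβc : Continuous β :=
    hα.comp_continuous (continuous_const.max continuous_id) fun t => mem_Ici.2 (le_max_left _ _)
  set A : ℝ → ℝ := fun t => ∫ s in t₀..t, β s with hA
  have hAα : ∀ t ∈ Ici t₀, A t = ∫ s in t₀..t, α s := fun t ht => by
    refine intervalIntegral.integral_congr fun s hs => ?_
    rw [uIcc_of_le ht] at hs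
    simp only [hβ, max_eq_right hs.1]
  have hA' : ∀ t, HasDerivAt A (β t) t := fun t => hβc.integral_hasStrictDerivAt t₀ t |>.hasDerivAt
  have hW : ∀ t ∈ Ici t₀, HasDerivWithinAt (fun τ => V τ * Real.exp (c * A τ))
      (V' t * Real.exp (c * A t) + V t * (Real.exp (c * A t) * (c * β t))) (Ici t₀) t :=
    fun t ht => (hV t ht).mul ((hA' t).const_mul c).exp.hasDerivWithinAt
  have hanti : AntitoneOn (fun τ => V τ * Real.exp (c * A τ)) (Ici t₀) := by
    refine antitoneOn_of_deriv_nonpos (convex_Ici t₀) (fun t ht => (hW t ht).continuousWithinAt)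
      (fun t ht => ?_) fun t ht => ?_
    · exact ((hW t (interior_subset ht)).mono interior_subset).differentiableWithinAt
    · have htm : t ∈ Ici t₀ := interior_subset ht
      rw [((hW t htm).hasDerivAt (mem_interior_iff_mem_nhds.1 ht)).deriv]
      have hβt : β t = α t := by simp only [hβ, max_eq_right (mem_Ici.1 htm)]
      rw [hβt]
      nlinarith [hV' t htm, Real.exp_pos (c * A t)]
  have hAtop : Tendsto A atTop atTop :=
    hdiv.congr' (by filter_upwards [eventually_ge_atTop t₀] with t ht using (hAα t ht).symm)
  have hexp : Tendsto (fun t => V t₀ * Real.exp (-(c * A t))) atTop (nhds 0) := by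
    simpa using ((Real.tendsto_exp_neg_atTop_nhds_zero.comp
      (hAtop.const_mul_atTop hc)).const_mul (V t₀))
  refine tendsto_of_tendsto_of_tendsto_of_le_of_le' tendsto_const_nhds hexp ?_ ?_
  · filter_upwards [eventually_ge_atTop t₀] with t ht using hV0 t ht
  · filter_upwards [eventually_ge_atTop t₀] with t ht
    have h := hanti (mem_Ici.2 le_rfl) ht ht
    simp only [hA, intervalIntegral.integral_same, mul_zero, Real.exp_zero, mul_one] at h
    rw [Real.exp_neg, ← div_eq_mul_inv, le_div_iff₀ (Real.exp_pos _)]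
    exact h

/-- Uniform decay rate in the Lyapunov inequality: `q`, `r`, `s` stand for `xᵀPx`, `vᵀPv`,
`xᵀPv`, and `X` for `|x|²`. -/
lemma exists_decay_rate {L γ k : ℝ} (hL : 0 < L) (hγ0 : 0 < γ) (hγ1 : γ < 1)
    (hk : L / (2 * γ * (1 - γ ^ 2)) < k) :
    ∃ c > 0, ∀ q r s X : ℝ, 0 ≤ q → 0 ≤ r → q ≤ L * X →
      (∀ b : ℝ, 0 ≤ b ^ 2 * q - 2 * b * s + r) →
      -(k * (1 - γ ^ 2) * X) + 2 * s - 2 * γ * r ≤ -(c * (q + r - 2 * γ * s)) := by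
  have hγ2 : 0 < 1 - γ ^ 2 := by nlinarith
  set μ := k * (1 - γ ^ 2) / L with hμ
  have hμγ : 1 / (2 * γ) < μ := by
    rw [div_lt_iff₀ (by positivity)] at hk
    rw [hμ, div_lt_div_iff₀ (by positivity) hL]
    linarith
  obtain ⟨b, hb1, hb2⟩ := exists_between hμγ
  have hb0 : 0 < b := lt_trans (by positivity) hb1
  have hb3 : 1 / b < 2 * γ := by
    rw [div_lt_iff₀ (by positivity)] at hb1 ⊢
    linarith
  refine ⟨min (μ - b) (2 * γ - 1 / b) / 2,
    half_pos (lt_min (sub_pos.2 hb2) (sub_pos.2 hb3)), fun q r s X hq hr hqX hs => ?_⟩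
  set d := min (μ - b) (2 * γ - 1 / b) with hd
  have hd0 : 0 < d := lt_min (sub_pos.2 hb2) (sub_pos.2 hb3)
  have hsb : 2 * s ≤ b * q + 1 / b * r := by
    have h := hs b
    have : b * q + 1 / b * r - 2 * s = (b ^ 2 * q - 2 * b * s + r) / b := by
      field_simp
      ring
    have : 0 ≤ (b ^ 2 * q - 2 * b * s + r) / b := by positivity
    linarith
  have hX : μ * q ≤ k * (1 - γ ^ 2) * X := by
    have hμ0 : 0 < μ := hb0.trans hb2
    have hkL : k * (1 - γ ^ 2) = μ * L := by rw [hμ]; field_simp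
    rw [hkL, mul_assoc]
    gcongr
  have hV : q + r - 2 * γ * s ≤ 2 * (q + r) := by
    nlinarith [hs (-1), hs 1]
  have h1 : d * q ≤ (μ - b) * q := by gcongr; exact min_le_left _ _
  have h2 : d * r ≤ (2 * γ - 1 / b) * r := by gcongr; exact min_le_right _ _
  have h3 : d / 2 * (q + r - 2 * γ * s) ≤ d / 2 * (2 * (q + r)) := by gcongr
  linarith

/-- Let `H ∈ ℝ^{n×n}` be positive stable, `Pbar` symmetric positive
definite with `Hᵀ Pbar + Pbar H = Iₙ`, `0 < γ < 1`, `k > λ_max(Pbar)/(2γ(1−γ²))`.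
Let `α` be continuous and positive on `[t₀,∞)` with `∫_{t₀}^t α → ∞` as `t → ∞`,
and let `F₀ = [[−kH, Iₙ], [−γkH, 0]]`. If `ε : [t₀,∞) → ℝ^{2n}` is differentiable and
satisfies the noise-free error dynamics `ε′(t) = α(t)·F₀·ε(t)` for all `t ≥ t₀`,
then `ε(t) → 0` as `t → ∞`. -/
theorem stmt13 (n : ℕ) (hn : 0 < n) (t₀ : ℝ) (H Pbar : Matrix (Fin n) (Fin n) ℝ)
    (hstable : ∀ μ ∈ spectrum ℂ (H.map (algebraMap ℝ ℂ)), 0 < μ.re)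
    (hP : Pbar.PosDef) (hPsym : Pbar.IsSymm)
    (hlyap : Hᵀ * Pbar + Pbar * H = 1)
    (γ k : ℝ) (hγ0 : 0 < γ) (hγ1 : γ < 1)
    (hk : k > (⨆ i, hP.1.eigenvalues i) / (2 * γ * (1 - γ ^ 2)))
    (α : ℝ → ℝ) (hαc : ContinuousOn α (Ici t₀)) (hαpos : ∀ t ∈ Ici t₀, 0 < α t)
    (hdiv : Tendsto (fun t => ∫ s in t₀..t, α s) atTop atTop)
    (ε : ℝ → (Fin n ⊕ Fin n → ℝ))
    (hε : ∀ t ∈ Ici t₀,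
      HasDerivWithinAt ε
        (α t • (Matrix.fromBlocks (-k • H) (1 : Matrix (Fin n) (Fin n) ℝ)
            (-(γ * k) • H) (0 : Matrix (Fin n) (Fin n) ℝ)).mulVec (ε t))
        (Ici t₀) t) :
    Tendsto ε atTop (nhds 0) := by
  have : Nonempty (Fin n) := ⟨⟨0, hn⟩⟩
  set L := ⨆ i, hP.1.eigenvalues i
  have hL0 : 0 < L := (hP.eigenvalues_pos ⟨0, hn⟩).trans_le
    (le_ciSup (Set.finite_range hP.1.eigenvalues).bddAbove _)
  obtain ⟨c, hc, hdecay⟩ := exists_decay_rate hL0 hγ0 hγ1 hk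
  set x : ℝ → Fin n → ℝ := fun t i => ε t (Sum.inl i) with hx
  set v : ℝ → Fin n → ℝ := fun t i => ε t (Sum.inr i) with hv
  have hεxv : ∀ t, ε t = Sum.elim (x t) (v t) := fun t => by
    ext (i | i) <;> rfl
  have hx' : ∀ t ∈ Ici t₀,
      HasDerivWithinAt x (α t • (-k • H *ᵥ x t + v t)) (Ici t₀) t := fun t ht => by
    refine hasDerivWithinAt_pi.2 fun i => ?_
    have h := hasDerivWithinAt_pi.1 (hε t ht) (Sum.inl i)
    rw [hεxv t, fromBlocks_mulVec] at h
    simpa [smul_mulVec, neg_mulVec] using h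
  have hv' : ∀ t ∈ Ici t₀,
      HasDerivWithinAt v (α t • (-(γ * k) • H *ᵥ x t)) (Ici t₀) t := fun t ht => by
    refine hasDerivWithinAt_pi.2 fun i => ?_
    have h := hasDerivWithinAt_pi.1 (hε t ht) (Sum.inr i)
    rw [hεxv t, fromBlocks_mulVec] at h
    simpa [smul_mulVec, neg_mulVec] using h
  have hlyap' : ∀ y : Fin n → ℝ, 2 * (y ⬝ᵥ Pbar *ᵥ (H *ᵥ y)) = y ⬝ᵥ y := fun y => by
    have h := congrArg (fun M => y ⬝ᵥ M *ᵥ y) hlyap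
    simp only [add_mulVec, one_mulVec, dotProduct_add, ← mulVec_mulVec] at h
    rw [dotProduct_mulVec y Hᵀ, vecMul_transpose, hPsym.dotProduct_mulVec_comm] at h
    linarith
  have hnn : ∀ y : Fin n → ℝ, 0 ≤ y ⬝ᵥ Pbar *ᵥ y := fun y => by
    simpa using hP.posSemidef.dotProduct_mulVec_nonneg y
  have hcs : ∀ y z : Fin n → ℝ, ∀ b : ℝ,
      0 ≤ b ^ 2 * (y ⬝ᵥ Pbar *ᵥ y) - 2 * b * (y ⬝ᵥ Pbar *ᵥ z) + z ⬝ᵥ Pbar *ᵥ z := fun y z b => by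
    have h := hnn (b • y - z)
    simp only [mulVec_sub, mulVec_smul, dotProduct_sub, sub_dotProduct, smul_dotProduct,
      dotProduct_smul, smul_eq_mul, hPsym.dotProduct_mulVec_comm z y] at h
    linarith
  set V : ℝ → ℝ := fun t =>
    x t ⬝ᵥ Pbar *ᵥ x t + v t ⬝ᵥ Pbar *ᵥ v t - 2 * γ * (x t ⬝ᵥ Pbar *ᵥ v t) with hVdef
  have hV' : ∀ t ∈ Ici t₀, HasDerivWithinAt V
      (α t * (-(k * (1 - γ ^ 2) * (x t ⬝ᵥ x t)) + 2 * (x t ⬝ᵥ Pbar *ᵥ v t)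
        - 2 * γ * (v t ⬝ᵥ Pbar *ᵥ v t))) (Ici t₀) t := fun t ht => by
    have h := (((hx' t ht).dotProduct_mulVec Pbar (hx' t ht)).add
      ((hv' t ht).dotProduct_mulVec Pbar (hv' t ht))).sub
      (((hx' t ht).dotProduct_mulVec Pbar (hv' t ht)).const_mul (2 * γ))
    refine h.congr_deriv ?_
    simp only [mulVec_add, mulVec_smul, dotProduct_add, add_dotProduct, smul_dotProduct,
      dotProduct_smul, smul_eq_mul, hPsym.dotProduct_mulVec_comm (v t) (x t),
      hPsym.dotProduct_mulVec_comm (H *ᵥ x t), ← hlyap']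
    ring
  have hVlow : ∀ t, (1 - γ) * (x t ⬝ᵥ Pbar *ᵥ x t + v t ⬝ᵥ Pbar *ᵥ v t) ≤ V t := fun t => by
    simp only [hVdef]
    nlinarith [hcs (x t) (v t) 1]
  have hVtend : Tendsto V atTop (nhds 0) := by
    refine tendsto_zero_of_deriv_le_neg_mul hc hαc hdiv hV' (fun t _ => ?_) fun t ht => ?_
    · exact (mul_nonneg (sub_nonneg.2 hγ1.le) (add_nonneg (hnn _) (hnn _))).trans (hVlow t)
    · have h := mul_le_mul_of_nonneg_left (hdecay _ _ _ _ (hnn (x t)) (hnn (v t))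
        (hP.1.dotProduct_mulVec_le_iSup_eigenvalues (x t)) (hcs (x t) (v t))) (hαpos t ht).le
      refine h.trans_eq ?_
      simp only [hVdef]
      ring
  obtain ⟨m, hm, hmle⟩ := hP.exists_pos_mul_le_dotProduct_mulVec
  have hsq : ∀ (y : Fin n → ℝ) (i : Fin n), y i ^ 2 ≤ y ⬝ᵥ y := fun y i => by
    rw [sq]
    exact Finset.single_le_sum (f := fun j => y j * y j) (fun j _ => mul_self_nonneg _)
      (Finset.mem_univ i)
  have hmγ : 0 < m * (1 - γ) := mul_pos hm (sub_pos.2 hγ1)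
  have hbound : ∀ t j, ε t j ^ 2 ≤ V t / (m * (1 - γ)) := fun t j => by
    rw [le_div_iff₀ hmγ]
    have hsum : ε t j ^ 2 ≤ x t ⬝ᵥ x t + v t ⬝ᵥ v t := by
      rcases j with i | i
      · linarith [hsq (x t) i, sq_nonneg (v t i), hsq (v t) i]
      · linarith [hsq (v t) i, sq_nonneg (x t i), hsq (x t) i]
    calc ε t j ^ 2 * (m * (1 - γ)) ≤ (x t ⬝ᵥ x t + v t ⬝ᵥ v t) * (m * (1 - γ)) := by gcongr
      _ = (1 - γ) * (m * (x t ⬝ᵥ x t) + m * (v t ⬝ᵥ v t)) := by ring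
      _ ≤ (1 - γ) * (x t ⬝ᵥ Pbar *ᵥ x t + v t ⬝ᵥ Pbar *ᵥ v t) :=
        mul_le_mul_of_nonneg_left (add_le_add (hmle _) (hmle _)) (sub_nonneg.2 hγ1.le)
      _ ≤ V t := hVlow t
  refine tendsto_pi_nhds.2 fun j => ?_
  have hsqt : Tendsto (fun t => ε t j ^ 2) atTop (nhds 0) :=
    squeeze_zero (fun t => sq_nonneg _) (fun t => hbound t j)
      (by simpa using hVtend.div_const (m * (1 - γ)))
  refine (tendsto_zero_iff_abs_tendsto_zero _).2 ?_
  simpa [Real.sqrt_sq_eq_abs, Function.comp_def] using hsqt.sqrt
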